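/- For rooted trees t₁ and t₂, (𝔑(t₁), 𝔑(t₂)) − (𝔓(t₁), 𝔓(t₂)) equals 0 if t₁ and t₂ are not isomorphic, and equals |t|·|SG(t)| if t₁ = t₂ = t. -/

import Mathlib

attribute [local instance] Classical.propDecidable

inductive PlanarTree : Type where
  | node : List PlanarTree → PlanarTree

namespace PlanarTree

/-- Isomorphism of (planar representatives of) rooted trees: the lists of
principal branches match up, pairwise isomorphically, after a permutation. -/
inductive Iso : PlanarTree → PlanarTree → Prop where
  | node {l m l' : List PlanarTree} :
      List.Perm l m → List.Forall₂ Iso m l' → Iso (node l) (node l')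

/-- Number of vertices. -/
def size : PlanarTree → ℕ
  | node l => 1 + (l.attach.map fun c => size c.1).sum
decreasing_by simp only [PlanarTree.node.sizeOf_spec]; exact Nat.lt_of_lt_of_le (List.sizeOf_lt_of_mem c.2) (Nat.le_add_left _ _)

mutual
  /-- All trees obtained by attaching the root of `s` by a new edge to some vertex. -/
  def graftList (s : PlanarTree) : PlanarTree → List PlanarTree
    | node l => node (s :: l) :: (graftAux s l).map node
  def graftAux (s : PlanarTree) : List PlanarTree → List (List PlanarTree)
    | [] => []
    | a :: l => ((graftList s a).map (· :: l)) ++ (graftAux s l).map (a :: ·)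
end

/-- All trees obtained by adding a new edge and terminal vertex at some vertex. -/
def growList (t : PlanarTree) : List PlanarTree := graftList (node []) t

mutual
  /-- All trees obtained by deleting one (non-root) terminal vertex. -/
  def pruneList : PlanarTree → List PlanarTree
    | node l => (pruneAux l).map node
  def pruneAux : List PlanarTree → List (List PlanarTree)
    | [] => []
    | a :: l =>
        (match a with | node [] => [l] | _ => []) ++
        ((pruneList a).map (· :: l)) ++ (pruneAux l).map (a :: ·)
end

mutual
  /-- All pairs (cut-off subtree, remaining tree) obtained by cutting one edge. -/
  def cutPairs : PlanarTree → List (PlanarTree × PlanarTree)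
    | node l => (cutAux l).map fun x => (x.1, node x.2)
  def cutAux : List PlanarTree → List (PlanarTree × List PlanarTree)
    | [] => []
    | a :: l =>
        (a, l) :: (((cutPairs a).map fun x => (x.1, x.2 :: l)) ++
          (cutAux l).map fun x => (x.1, a :: x.2))
end

/-- The order of the symmetry group `SG(t)`: the product over all vertices `v`
of the number of permutations of the branches at `v` exchanging isomorphic branches. -/
noncomputable def sg : PlanarTree → ℕ
  | node l =>
      (l.attach.map fun c => sg c.1).prod *
        Nat.card {σ : Equiv.Perm (Fin l.length) // ∀ i, Iso (l.get (σ i)) (l.get i)}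
decreasing_by simp only [PlanarTree.node.sizeOf_spec]; exact Nat.lt_of_lt_of_le (List.sizeOf_lt_of_mem c.2) (Nat.le_add_left _ _)

/-- Vertices of a planar tree, encoded as paths of child-indices from the root. -/
inductive IsVertex : PlanarTree → List ℕ → Prop where
  | root (t : PlanarTree) : IsVertex t []
  | child {l : List PlanarTree} {i : ℕ} {c : PlanarTree} {p : List ℕ} :
      l[i]? = some c → IsVertex c p → IsVertex (node l) (i :: p)

def Vertex (t : PlanarTree) : Type := {p : List ℕ // IsVertex t p}

/-- `v` lies strictly below `w` in the tree order (i.e. `w` is a proper ancestor of `v`). -/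
def StrictBelow {t : PlanarTree} (v w : Vertex t) : Prop := w.1 <+: v.1 ∧ w.1 ≠ v.1

/-- A labelling of `t`. -/
def Labelling (t : PlanarTree) : Type :=
  {f : Vertex t ≃ Fin t.size // ∀ v w, StrictBelow v w → f w < f v}

/-- Equivalence of labellings: they differ by an automorphism of the rooted tree. -/
def labelEquiv {t : PlanarTree} (f g : Labelling t) : Prop :=
  ∃ φ : Equiv.Perm (Vertex t),
    (∀ v w, StrictBelow (φ v) (φ w) ↔ StrictBelow v w) ∧ ∀ v, f.1 (φ v) = g.1 v

end PlanarTree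

/-- Rooted trees: isomorphism classes of planar rooted trees. -/
instance planarSetoid : Setoid PlanarTree := Relation.EqvGen.setoid PlanarTree.Iso

def RTree : Type := Quotient planarSetoid

namespace RTree

def mk (p : PlanarTree) : RTree := ⟦p⟧

/-- A chosen planar representative. -/
noncomputable def rep (T : RTree) : PlanarTree := Quotient.out T

noncomputable def size (T : RTree) : ℕ := T.rep.size

/-- The order of the symmetry (automorphism) group of `T`. -/
noncomputable def sg (T : RTree) : ℕ := T.rep.sg

/-- The one-vertex tree. -/
def bullet : RTree := mk (PlanarTree.node [])

/-- `Covers T T'` means `T ⊲ T'`: `T` is obtained from `T'` by deleting one terminal vertex. -/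
noncomputable def Covers (T T' : RTree) : Prop :=
  ∃ p ∈ T'.rep.pruneList, mk p = T

/-- `n(T;T')`: the number of vertices of `T` to which a new edge can be added to obtain `T'`. -/
noncomputable def nCov (T T' : RTree) : ℕ :=
  T.rep.growList.countP fun p => decide (mk p = T')

/-- `m(T;T')`: the number of (terminal) edges of `T'` which when removed leave `T`. -/
noncomputable def mCov (T T' : RTree) : ℕ :=
  T'.rep.pruneList.countP fun p => decide (mk p = T)

/-- `n(T₁,T₂;T₃)`: the number of vertices of `T₂` such that attaching the root of `T₁`
there by a new edge yields `T₃`. -/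
noncomputable def nTri (T₁ T₂ T₃ : RTree) : ℕ :=
  (PlanarTree.graftList T₁.rep T₂.rep).countP fun p => decide (mk p = T₃)

/-- `m(T₁,T₂;T₃)`: the number of edges of `T₃` whose removal cuts off a subtree
isomorphic to `T₁` leaving `T₂` (the piece containing the root). -/
noncomputable def mTri (T₁ T₂ T₃ : RTree) : ℕ :=
  T₃.rep.cutPairs.countP fun x => decide (mk x.1 = T₁ ∧ mk x.2 = T₂)

end RTree

section Ops

variable (k : Type*) [Semiring k]

/-- The element `𝔑(T) = Σ_{T ⊲ T'} n(T;T')·T'` of `k{T}`. -/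
noncomputable def growF (T : RTree) : RTree →₀ k :=
  (T.rep.growList.map fun p => Finsupp.single (RTree.mk p) (1 : k)).sum

/-- The element `𝔓(T) = Σ_{T' ⊲ T} m(T';T)·T'` of `k{T}`. -/
noncomputable def pruneF (T : RTree) : RTree →₀ k :=
  (T.rep.pruneList.map fun p => Finsupp.single (RTree.mk p) (1 : k)).sum

/-- The growth operator `𝔑` on `k{T}`. -/
noncomputable def Grow : Module.End k (RTree →₀ k) :=
  Finsupp.linearCombination k (growF k)

/-- The pruning operator `𝔓` on `k{T}`. -/
noncomputable def Prune : Module.End k (RTree →₀ k) :=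
  Finsupp.linearCombination k (pruneF k)

/-- The operator `𝔇` on `k{T}`, `𝔇(t) = |t|·t`. -/
noncomputable def Diag : Module.End k (RTree →₀ k) :=
  Finsupp.linearCombination k fun T => (T.size : k) • Finsupp.single T 1

/-- The inner product on `k{T}` determined by `(t,t') = |SG(t)|·δ_{t,t'}`. -/
noncomputable def innerT (x y : RTree →₀ k) : k :=
  x.sum fun T c => c * y T * (T.sg : k)

/-- Generalized multiplicity `n(T;T')`: coefficient of `T'` in `𝔑^{|T'|-|T|}(T)`. -/
noncomputable def nGen (T T' : RTree) : k :=
  ((Grow k ^ (T'.size - T.size)) (Finsupp.single T 1)) T'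

/-- Generalized multiplicity `m(T;T')`: coefficient of `T` in `𝔓^{|T'|-|T|}(T')`. -/
noncomputable def mGen (T T' : RTree) : k :=
  ((Prune k ^ (T'.size - T.size)) (Finsupp.single T' 1)) T

end Ops

section Kreimer

variable (k : Type*) [CommSemiring k]

/-- Kreimer's Hopf algebra `H_K`, as a commutative algebra: the free polynomial
algebra on rooted trees. -/
abbrev HK := MvPolynomial RTree k

/-- The inclusion `k{T} → H_K` of the linear span of the variables. -/
noncomputable def toHK : (RTree →₀ k) →ₗ[k] HK k :=
  Finsupp.linearCombination k fun T => MvPolynomial.X T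

/-- The growth derivation `N` on `H_K`, with `N(t) = 𝔑(t)` for rooted trees `t`. -/
noncomputable def ND : Derivation k (HK k) (HK k) :=
  MvPolynomial.mkDerivation k fun T => toHK k (growF k T)

/-- The pruning derivation `P` on `H_K`, with `P(t) = 𝔓(t)` for `|t| ≥ 2`, `P(•) = 1`. -/
noncomputable def PD : Derivation k (HK k) (HK k) :=
  MvPolynomial.mkDerivation k fun T =>
    if T = RTree.bullet then 1 else toHK k (pruneF k T)

/-- The grading derivation `D` on `H_K`, multiplying each homogeneous element of
degree `n` by `n`; it is the derivation with `D(t) = |t|·t` for rooted trees `t`. -/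
noncomputable def DD : Derivation k (HK k) (HK k) :=
  MvPolynomial.mkDerivation k fun T => (T.size : k) • MvPolynomial.X T

/-- The map `B₊ : H_K → k{T}` sending a forest to the tree obtained by attaching
all its roots to a new root vertex. -/
noncomputable def forestTree (d : RTree →₀ ℕ) : RTree :=
  RTree.mk (PlanarTree.node
    (d.support.toList.flatMap fun T => List.replicate (d T) T.rep))

noncomputable def Bplus (p : HK k) : RTree →₀ k :=
  ∑ d ∈ p.support, Finsupp.single (forestTree d) (MvPolynomial.coeff d p)

/-- The inner product on `H_K`. -/
noncomputable def innerHK (u v : HK k) : k := innerT k (Bplus k u) (Bplus k v)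

/-- The degree-`n` homogeneous component of `H_K`. -/
noncomputable abbrev HKcomp (n : ℕ) : Submodule k (HK k) :=
  MvPolynomial.weightedHomogeneousSubmodule k (fun T : RTree => T.size) n

/-- `T_i`: the number of rooted trees with `i+1` vertices. -/
noncomputable def Tcard (i : ℕ) : ℕ := Nat.card {T : RTree // T.size = i + 1}

end Kreimer

theorem List.sum_map_sum_map_comm {α β M : Type*} [AddCommMonoid M]
    (l : List α) (m : List β) (f : α → β → M) :
    (l.map fun a => (m.map fun b => f a b).sum).sum =
      (m.map fun b => (l.map fun a => f a b).sum).sum := by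
  induction l with
  | nil => simp
  | cons a l ih => simp [ih, List.sum_map_add]

namespace PlanarTree

@[elab_as_elim]
theorem node_induction {P : PlanarTree → Prop}
    (h : ∀ l : List PlanarTree, (∀ c ∈ l, P c) → P (node l)) (t : PlanarTree) : P t := by
  refine PlanarTree.rec (motive_1 := P) (motive_2 := fun l => ∀ c ∈ l, P c) h ?_ ?_ t
  · simp
  · intro a l ha hl
    simpa using ⟨ha, hl⟩

section Isomorphism

theorem Iso.of_forall₂_perm {l w l' : List PlanarTree} (h : List.Forall₂ Iso l w)
    (hw : List.Perm w l') : Iso (PlanarTree.node l) (PlanarTree.node l') := by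
  have : Relation.Comp (List.Forall₂ Iso) List.Perm l l' := ⟨w, h, hw⟩
  rw [List.forall₂_comp_perm_eq_perm_comp_forall₂] at this
  obtain ⟨m, hm, hm'⟩ := this
  exact .node hm hm'

theorem Iso.refl (p : PlanarTree) : Iso p p := by
  induction p using node_induction with
  | h l ih => exact .node (.refl l) (List.forall₂_same.2 ih)

theorem Iso.symm {p q : PlanarTree} (h : Iso p q) : Iso q p := by
  induction p using node_induction generalizing q with
  | h l ih =>
    obtain ⟨hl, hm⟩ := h
    rename_i m l'
    refine .of_forall₂_perm (w := m) ?_ hl.symm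
    have : List.Forall₂ (flip Iso) m l' :=
      ((List.forall₂_and_left (p := (· ∈ l)) m l').2 ⟨fun x hx => hl.mem_iff.2 hx, hm⟩).imp
        fun a b hab => ih a hab.1 hab.2
    exact this.flip

theorem Iso.trans {p q r : PlanarTree} (hpq : Iso p q) (hqr : Iso q r) : Iso p r := by
  induction p using node_induction generalizing q r with
  | h l ih =>
    obtain ⟨hl, hm⟩ := hpq
    obtain ⟨hl', hm'⟩ := hqr
    obtain ⟨w, hw, hw'⟩ := List.perm_comp_forall₂ hl hm
    obtain ⟨v, hv, hv'⟩ := List.perm_comp_forall₂ (hw'.trans hl') hm'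
    refine .of_forall₂_perm (w := v) ?_ hv'
    clear hl hm hl' hm' hw' hv'
    induction hw generalizing v with
    | nil => cases hv; exact .nil
    | cons hab _ IH =>
      cases hv with
      | cons hbc hv =>
        exact .cons (ih _ (by simp) hab hbc)
          (IH (fun c hc => ih c (List.mem_cons_of_mem _ hc)) _ hv)

theorem mk_eq_mk_iff {p q : PlanarTree} : RTree.mk p = RTree.mk q ↔ Iso p q := by
  refine ⟨fun h => ?_, fun h => Quotient.sound (Relation.EqvGen.rel _ _ h)⟩
  have h' : Relation.EqvGen Iso p q := Quotient.exact h
  rwa [Equivalence.eqvGen_iff ⟨Iso.refl, Iso.symm, Iso.trans⟩] at h'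

theorem mk_rep (T : RTree) : RTree.mk T.rep = T := Quotient.out_eq T

theorem mk_node_eq_iff {l l' : List PlanarTree} :
    RTree.mk (node l) = RTree.mk (node l') ↔ (l.map RTree.mk).Perm (l'.map RTree.mk) := by
  have hforall (m n : List PlanarTree) :
      List.Forall₂ Iso m n ↔ m.map RTree.mk = n.map RTree.mk := by
    rw [← List.forall₂_eq_eq_eq, List.forall₂_map_left_iff, List.forall₂_map_right_iff]
    simp only [mk_eq_mk_iff]
  rw [mk_eq_mk_iff]
  constructor
  · rintro ⟨hl, hm⟩
    rw [← (hforall _ _).1 hm]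
    exact hl.map _
  · intro h
    obtain ⟨w, hw, hw'⟩ := List.perm_comp_forall₂ (r := fun T p => T = RTree.mk p) (v := l') h
      (List.forall₂_map_left_iff.2 (List.forall₂_same.2 fun _ _ => rfl))
    rw [List.forall₂_map_left_iff] at hw
    exact .of_forall₂_perm (hw.imp fun _ _ => mk_eq_mk_iff.1) hw'

end Isomorphism

section Symmetry

theorem card_perm_iso (l : List PlanarTree) :
    Nat.card {σ : Equiv.Perm (Fin l.length) // ∀ i, Iso (l.get (σ i)) (l.get i)} =
      ∏ x ∈ (l.map RTree.mk).toFinset, ((l.map RTree.mk).count x).factorial := by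
  have hmap : (Finset.univ.val.map l.get : Multiset PlanarTree) = l := by
    rw [Fin.univ_val_map, List.ofFn_get]
  rw [Nat.card_congr (Equiv.subtypeEquivRight (q := fun σ : Equiv.Perm (Fin l.length) =>
    (RTree.mk ∘ l.get) ∘ σ = RTree.mk ∘ l.get) fun σ => by
      simp [funext_iff, mk_eq_mk_iff]), Nat.card_eq_fintype_card]
  convert DomMulAct.stabilizer_card' (RTree.mk ∘ l.get) using 2
  · ext x
    simp only [List.mem_toFinset, List.mem_map, List.mem_iff_get (l := l)]
    simp
  · rename_i x _
    rw [Fintype.card_subtype, ← Multiset.coe_count, ← Multiset.map_coe, ← hmap, Multiset.map_map,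
      Multiset.count_map]
    simp [Finset.card, Finset.filter, eq_comm]

theorem sg_node (l : List PlanarTree) :
    sg (node l) = (l.map sg).prod *
      ∏ x ∈ (l.map RTree.mk).toFinset, ((l.map RTree.mk).count x).factorial := by
  rw [sg, card_perm_iso]
  simp

theorem sg_nil : sg (node []) = 1 := by simp [sg_node]

theorem size_node (l : List PlanarTree) : size (node l) = 1 + (l.map size).sum := by
  rw [size]
  simp

theorem sg_node_cons (a : PlanarTree) (l : List PlanarTree) :
    sg (node (a :: l)) =
      ((a :: l).map RTree.mk).count (RTree.mk a) * (sg a * sg (node l)) := by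
  have key (m : List RTree) (x : RTree) :
      ∏ y ∈ (x :: m).toFinset, ((x :: m).count y).factorial =
        (x :: m).count x * ∏ y ∈ m.toFinset, (m.count y).factorial := by
    have h1 : ∏ y ∈ m.toFinset, (m.count y).factorial =
        ∏ y ∈ (x :: m).toFinset, (m.count y).factorial := by
      refine Finset.prod_subset (by simp) fun y _ hy => ?_
      rw [List.count_eq_zero_of_not_mem (by simpa using hy), Nat.factorial_zero]
    have hx : x ∈ (x :: m).toFinset := by simp
    rw [h1, ← Finset.mul_prod_erase _ _ hx, ← Finset.mul_prod_erase _ _ hx, ← mul_assoc,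
      List.count_cons_self, Nat.factorial_succ]
    congr 1
    refine Finset.prod_congr rfl fun y hy => ?_
    rw [List.count_cons_of_ne (Finset.ne_of_mem_erase hy).symm]
  rw [sg_node, sg_node, List.map_cons, List.map_cons, List.prod_cons, key]
  ring

theorem sg_eq_of_mk_eq {p q : PlanarTree} (h : RTree.mk p = RTree.mk q) : sg p = sg q := by
  induction p using node_induction generalizing q with
  | h l ih =>
    obtain ⟨l'⟩ := q
    have hp := mk_node_eq_iff.1 h
    obtain ⟨hl, hm⟩ := mk_eq_mk_iff.1 h
    rename_i m
    rw [sg_node, sg_node]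
    congr 1
    · rw [(hl.map sg).prod_eq]
      congr 1
      rw [← List.forall₂_eq_eq_eq, List.forall₂_map_left_iff, List.forall₂_map_right_iff]
      exact ((List.forall₂_and_left (p := (· ∈ l)) m l').2 ⟨fun x hx => hl.mem_iff.2 hx, hm⟩).imp
        fun a b hab => ih a hab.1 (mk_eq_mk_iff.2 hab.2)
    · rw [List.toFinset_eq_of_perm _ _ hp]
      exact Finset.prod_congr rfl fun x _ => by rw [hp.count_eq]

end Symmetry

section Sums

variable {M : Type*} [AddCommMonoid M]

theorem sum_growList_node (l : List PlanarTree) (φ : PlanarTree → M) :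
    ((growList (node l)).map φ).sum =
      φ (node (node [] :: l)) +
        ((graftAux (node []) l).map fun L => φ (node L)).sum := by
  simp [growList, graftList, Function.comp_def]

theorem sum_graftAux_cons (a : PlanarTree) (l : List PlanarTree) (φ : List PlanarTree → M) :
    ((graftAux (node []) (a :: l)).map φ).sum =
      ((growList a).map fun b => φ (b :: l)).sum +
        ((graftAux (node []) l).map fun L => φ (a :: L)).sum := by
  simp [growList, graftAux, Function.comp_def]

theorem sum_pruneList_node (l : List PlanarTree) (φ : PlanarTree → M) :
    ((pruneList (node l)).map φ).sum = ((pruneAux l).map fun L => φ (node L)).sum := by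
  simp [pruneList, Function.comp_def]

theorem sum_pruneAux_cons (a : PlanarTree) (l : List PlanarTree) (φ : List PlanarTree → M) :
    ((pruneAux (a :: l)).map φ).sum =
      (if a = node [] then φ l else 0) + ((pruneList a).map fun b => φ (b :: l)).sum +
        ((pruneAux l).map fun L => φ (a :: L)).sum := by
  obtain ⟨_ | ⟨b, m⟩⟩ := a <;> simp [pruneAux, Function.comp_def, add_assoc]

theorem ne_leaf_of_mem_growList {a b : PlanarTree} (h : b ∈ growList a) : b ≠ node [] := by
  obtain ⟨l⟩ := a
  rintro rfl
  have hAux : ∀ l : List PlanarTree, [] ∉ graftAux (node []) l := by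
    intro l
    induction l <;> simp [graftAux]
  simp [growList, graftList, hAux] at h

/-- Growing and then pruning, compared with pruning and then growing: the relation
`[𝔓, 𝔑] = 𝔇` on planar representatives. -/
theorem sum_grow_prune (t : PlanarTree) (φ : PlanarTree → M) :
    ((growList t).map fun p => ((pruneList p).map φ).sum).sum =
      ((pruneList t).map fun p => ((growList p).map φ).sum).sum + size t • φ t := by
  induction t using node_induction generalizing φ with
  | h l ih =>
    have aux (ψ : List PlanarTree → M) :
        ((graftAux (node []) l).map fun L => ((pruneAux L).map ψ).sum).sum =
          ((pruneAux l).map fun L => ((graftAux (node []) L).map ψ).sum).sum +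
            (l.map size).sum • ψ l := by
      induction l generalizing ψ with
      | nil => simp [graftAux, pruneAux]
      | cons a l IH =>
        have hgrow : ((growList a).map fun b => ((pruneAux (b :: l)).map ψ).sum) =
            (growList a).map fun b => ((pruneList b).map fun c => ψ (c :: l)).sum +
              ((pruneAux l).map fun L => ψ (b :: L)).sum := by
          refine List.map_congr_left fun b hb => ?_
          rw [sum_pruneAux_cons, if_neg (ne_leaf_of_mem_growList hb), zero_add]
        have IH' := IH (fun c hc => ih c (List.mem_cons_of_mem _ hc)) fun L => ψ (a :: L)
        have iha := ih a (by simp) fun b => ψ (b :: l)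
        rw [sum_graftAux_cons, sum_pruneAux_cons, hgrow]
        simp only [sum_pruneAux_cons, sum_graftAux_cons, List.sum_map_add, IH', iha,
          List.map_cons, List.sum_cons, add_smul]
        rw [List.sum_map_sum_map_comm (growList a), List.sum_map_sum_map_comm (pruneList a)]
        by_cases ha : a = node [] <;> simp [ha] <;> abel
    simp only [sum_growList_node, sum_pruneList_node, sum_pruneAux_cons, List.sum_map_add, aux,
      size_node, add_smul, one_smul, if_true]
    simp only [pruneAux, List.map_nil, List.sum_nil]
    abel

end Sums

section Adjointness

/-- All ways of singling out one entry of a list, paired with the remaining list. -/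
def picks : List PlanarTree → List (PlanarTree × List PlanarTree)
  | [] => []
  | a :: l => (a, l) :: (picks l).map fun x => (x.1, a :: x.2)

theorem perm_of_mem_picks {l : List PlanarTree} {x : PlanarTree × List PlanarTree}
    (hx : x ∈ picks l) : l.Perm (x.1 :: x.2) := by
  induction l generalizing x with
  | nil => simp [picks] at hx
  | cons a l ih =>
    simp only [picks, List.mem_cons, List.mem_map] at hx
    obtain rfl | ⟨y, hy, rfl⟩ := hx
    · exact .refl _
    · exact ((ih hy).cons a).trans (.swap _ _ _)

theorem map_fst_picks (l : List PlanarTree) : (picks l).map Prod.fst = l := by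
  induction l with
  | nil => rfl
  | cons a l ih => simpa [picks, Function.comp_def] using ih

theorem sum_picks_cons {M : Type*} [AddCommMonoid M] (a : PlanarTree) (l : List PlanarTree)
    (φ : PlanarTree × List PlanarTree → M) :
    ((picks (a :: l)).map φ).sum = φ (a, l) + ((picks l).map fun x => φ (x.1, a :: x.2)).sum := by
  simp [picks, Function.comp_def]

theorem sum_prune_picks {M : Type*} [AddCommMonoid M] (l : List PlanarTree)
    (g : PlanarTree → List PlanarTree → M) :
    ((pruneAux l).map fun L => ((picks L).map fun x => g x.1 x.2).sum).sum =
      ((picks l).map fun x => ((pruneList x.1).map fun b => g b x.2).sum +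
        ((pruneAux x.2).map fun L => g x.1 L).sum).sum := by
  induction l generalizing g with
  | nil => simp [picks, pruneAux]
  | cons c l ih =>
    have ihc := ih fun b L => g b (c :: L)
    simp only [sum_pruneAux_cons, sum_picks_cons, List.sum_map_add] at ihc ⊢
    rw [ihc, List.sum_map_sum_map_comm (pruneList c)]
    by_cases hc : c = node [] <;> simp [hc] <;> abel

variable (k : Type*) [CommSemiring k]

/-- The inner product of two planar representatives: the number of isomorphisms between them. -/
noncomputable def isoCount (p q : PlanarTree) : k :=
  if RTree.mk p = RTree.mk q then (sg p : k) else 0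

theorem isoCount_comm (p q : PlanarTree) : isoCount k p q = isoCount k q p := by
  unfold isoCount
  by_cases h : RTree.mk p = RTree.mk q
  · rw [if_pos h, if_pos h.symm, sg_eq_of_mk_eq h]
  · rw [if_neg h, if_neg (Ne.symm h)]

theorem isoCount_congr {p p' q q' : PlanarTree} (hp : RTree.mk p = RTree.mk p')
    (hq : RTree.mk q = RTree.mk q') : isoCount k p q = isoCount k p' q' := by
  simp only [isoCount, hp, hq, sg_eq_of_mk_eq hp]

theorem isoCount_nil (l : List PlanarTree) :
    isoCount k (node []) (node l) = if l = [] then 1 else 0 := by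
  have : RTree.mk (node []) = RTree.mk (node l) ↔ l = [] := by
    rw [mk_node_eq_iff]
    simp
  simp [isoCount, this, sg_nil]

/-- Expansion of the number of isomorphisms along the image of the first branch. -/
theorem isoCount_cons (a : PlanarTree) (l l' : List PlanarTree) :
    isoCount k (node (a :: l)) (node l') =
      ((picks l').map fun x => isoCount k a x.1 * isoCount k (node l) (node x.2)).sum := by
  by_cases h : RTree.mk (node (a :: l)) = RTree.mk (node l')
  · have hp := mk_node_eq_iff.1 h
    have hterm : ((picks l').map fun x => isoCount k a x.1 * isoCount k (node l) (node x.2)) =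
        ((picks l').map Prod.fst).map fun b =>
          if RTree.mk b = RTree.mk a then ((sg a * sg (node l) : ℕ) : k) else 0 := by
      rw [List.map_map]
      refine List.map_congr_left fun x hx => ?_
      by_cases hx' : RTree.mk x.1 = RTree.mk a
      · have : RTree.mk (node l) = RTree.mk (node x.2) := by
          rw [mk_node_eq_iff]
          have := hp.trans ((perm_of_mem_picks hx).map _)
          rw [List.map_cons, List.map_cons, hx'] at this
          exact this.cons_inv
        simp [isoCount, hx', this]
      · simp [isoCount, hx', Ne.symm hx']
    rw [hterm, map_fst_picks, isoCount, if_pos h, sg_node_cons, hp.count_eq]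
    clear h hp hterm
    induction l' with
    | nil => simp
    | cons b l' ih =>
      rw [List.map_cons, List.map_cons, List.sum_cons, ← ih, List.count_cons]
      by_cases hb : RTree.mk b = RTree.mk a
      · simp [hb]; ring
      · simp [hb]
  · rw [isoCount, if_neg h]
    symm
    refine List.sum_eq_zero fun y hy => ?_
    obtain ⟨x, hx, rfl⟩ := List.mem_map.1 hy
    unfold isoCount
    by_cases h1 : RTree.mk a = RTree.mk x.1
    · by_cases h2 : RTree.mk (node l) = RTree.mk (node x.2)
      · refine absurd ?_ h
        rw [mk_node_eq_iff] at h2 ⊢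
        refine .trans ?_ ((perm_of_mem_picks hx).map _).symm
        rw [List.map_cons, List.map_cons, h1]
        exact h2.cons _
      · simp [h2]
    · simp [h1]

theorem isoCount_cons_cons (a b : PlanarTree) (l l' : List PlanarTree) :
    isoCount k (node (a :: b :: l)) (node l') = isoCount k (node (b :: a :: l)) (node l') :=
  isoCount_congr k (mk_node_eq_iff.2 ((List.Perm.swap b a l).map _)) rfl

/-- Growth and pruning are adjoint for the inner product. -/
theorem sum_grow_isoCount (s t : PlanarTree) :
    ((growList s).map fun p => isoCount k p t).sum =
      ((pruneList t).map fun q => isoCount k s q).sum := by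
  induction s using node_induction generalizing t with
  | h l ih =>
    obtain ⟨l'⟩ := t
    rw [sum_growList_node, sum_pruneList_node]
    induction l generalizing l' with
    | nil =>
      simp only [isoCount_cons, isoCount_nil]
      rcases l' with _ | ⟨⟨_ | ⟨c, m⟩⟩, _ | ⟨d, l'⟩⟩
      all_goals simp [picks, pruneAux, graftAux, pruneList, isoCount_nil, Function.comp_def]
    | cons a l IH =>
      have IH' (L : List PlanarTree) := IH (fun c hc => ih c (List.mem_cons_of_mem _ hc)) L
      have iha (b : PlanarTree) := ih a (by simp) b
      have hprune := sum_prune_picks l' fun b L => isoCount k a b * isoCount k (node l) (node L)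
      simp only [← isoCount_cons] at hprune
      rw [hprune, sum_graftAux_cons, isoCount_cons_cons]
      simp only [isoCount_cons k _ l l', isoCount_cons k a]
      rw [List.sum_map_sum_map_comm, List.sum_map_sum_map_comm (graftAux _ _)]
      rw [add_left_comm, ← List.sum_map_add, ← List.sum_map_add]
      congr 1
      refine List.map_congr_left fun x _ => ?_
      rw [List.sum_map_mul_right, List.sum_map_mul_left, List.sum_map_mul_left,
        List.sum_map_mul_right, iha, ← IH']
      ring

end Adjointness

section InnerProduct

variable (k : Type*) [CommSemiring k]

theorem innerT_sum_single (l m : List PlanarTree) :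
    innerT k (l.map fun p => Finsupp.single (RTree.mk p) (1 : k)).sum
        (m.map fun p => Finsupp.single (RTree.mk p) (1 : k)).sum =
      (l.map fun p => (m.map fun q => isoCount k p q).sum).sum := by
  have hsg (p : PlanarTree) : (RTree.mk p).sg = sg p := sg_eq_of_mk_eq (mk_rep _)
  induction l with
  | nil => simp [innerT]
  | cons a l ih =>
    rw [List.map_cons, List.sum_cons, List.map_cons, List.sum_cons, ← ih]
    unfold innerT
    rw [Finsupp.sum_add_index' (by simp) (by intros; ring), Finsupp.sum_single_index (by simp)]
    congr 1
    rw [one_mul, hsg]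
    clear ih
    induction m with
    | nil => simp
    | cons b m ih =>
      rw [List.map_cons, List.sum_cons, List.map_cons, List.sum_cons, ← ih, Finsupp.add_apply,
        add_mul, Finsupp.single_apply, isoCount]
      by_cases h : RTree.mk a = RTree.mk b
      · simp [h]
      · simp [h, Ne.symm h]

end InnerProduct

end PlanarTree

/-- `(𝔑t₁,𝔑t₂) - (𝔓t₁,𝔓t₂)` is `0` for `t₁ ≠ t₂` and `|t|·|SG(t)|`
for `t₁ = t₂ = t`. -/
theorem stmt3 (k : Type*) [Field k] [CharZero k] (t₁ t₂ : RTree) :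
    innerT k (Grow k (Finsupp.single t₁ 1)) (Grow k (Finsupp.single t₂ 1))
      - innerT k (Prune k (Finsupp.single t₁ 1)) (Prune k (Finsupp.single t₂ 1))
      = if t₁ = t₂ then ((t₁.size * t₁.sg : ℕ) : k) else 0 := by
  have hG (T : RTree) : Grow k (Finsupp.single T 1) = growF k T := by
    simp [Grow]
  have hP (T : RTree) : Prune k (Finsupp.single T 1) = pruneF k T := by
    simp [Prune]
  rw [hG, hG, hP, hP, growF, growF, pruneF, pruneF, PlanarTree.innerT_sum_single,
    PlanarTree.innerT_sum_single, List.sum_map_sum_map_comm]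
  simp only [PlanarTree.sum_grow_isoCount]
  rw [PlanarTree.sum_grow_prune, List.sum_map_sum_map_comm t₁.rep.pruneList]
  have hcross (p : PlanarTree) :
      (p.growList.map fun q => PlanarTree.isoCount k t₁.rep q).sum =
        (t₁.rep.pruneList.map fun q => PlanarTree.isoCount k q p).sum := by
    simp only [PlanarTree.isoCount_comm k t₁.rep, PlanarTree.isoCount_comm k _ p]
    exact PlanarTree.sum_grow_isoCount k p t₁.rep
  simp only [hcross, add_sub_cancel_left]
  rw [PlanarTree.isoCount, PlanarTree.mk_rep, PlanarTree.mk_rep]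
  by_cases h : t₁ = t₂
  · subst h
    simp [RTree.size, RTree.sg]
  · simp [h]
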